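/- arXiv:0707.2360 — 7 statements merged into one kernel-verified Lean document; each statement's English description precedes it below -/
import Mathlib

section
/- Let 𝔉 and 𝔉' be lists of Y-local functions over the same graph Y and let H : (Fin n → 𝔽) → (Fin n → 𝔽) be a bijection. (i) If H ∘ [𝔉,ω] = [𝔉',ω'] ∘ H for update orders ω, ω', then H maps Per[𝔉,ω] bijectively onto Per[𝔉',ω']. (ii) If, in addition, 𝔉' is ω-independent and for every update order ω there exists an update order ω' with H ∘ [𝔉,ω] = [𝔉',ω'] ∘ H, then 𝔉 is ω-independent. -/
/-- `F` is `Y`-local at `i`: it only alters the `i`-th coordinate, and the new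
value only depends on the coordinates at `i` and its neighbors in `Y`. -/
def IsLocalAt {n : ℕ} {𝔽 : Type*} (Y : SimpleGraph (Fin n))
    (F : (Fin n → 𝔽) → (Fin n → 𝔽)) (i : Fin n) : Prop :=
  (∀ y : Fin n → 𝔽, ∀ j : Fin n, j ≠ i → F y j = y j) ∧
  (∀ y z : Fin n → 𝔽, y i = z i → (∀ j : Fin n, Y.Adj i j → y j = z j) →
    F y i = F z i)

/-- The SDS map `[𝔉,ω] = F_{ω_m} ∘ ⋯ ∘ F_{ω_1}`. -/
def sdsMap {n : ℕ} {𝔽 : Type*} (𝔉 : Fin n → (Fin n → 𝔽) → (Fin n → 𝔽))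
    (ω : List (Fin n)) (y : Fin n → 𝔽) : Fin n → 𝔽 :=
  ω.foldl (fun s i => 𝔉 i s) y

/-- An update order: a list containing every vertex at least once. -/
def IsUpdateOrderSDS {n : ℕ} (ω : List (Fin n)) : Prop :=
  ∀ v : Fin n, v ∈ ω

/-- A simple update order: a list containing every vertex exactly once. -/
def IsSimpleOrderSDS {n : ℕ} (ω : List (Fin n)) : Prop :=
  ω.Nodup ∧ ∀ v : Fin n, v ∈ ω

/-- `y` is periodic for `F` if some positive iterate of `F` returns `y` to itself. -/
def IsPeriodicState {α : Type*} (F : α → α) (y : α) : Prop :=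
  ∃ m : ℕ, 1 ≤ m ∧ F^[m] y = y

/-- `Per[𝔉,ω]`: the set of periodic states of the SDS map. -/
def perSDS {n : ℕ} {𝔽 : Type*} (𝔉 : Fin n → (Fin n → 𝔽) → (Fin n → 𝔽))
    (ω : List (Fin n)) : Set (Fin n → 𝔽) :=
  {y | IsPeriodicState (sdsMap 𝔉 ω) y}

/-- `𝔉` is ω-independent: all update orders give the same set of periodic states. -/
def OmegaIndepSDS {n : ℕ} {𝔽 : Type*}
    (𝔉 : Fin n → (Fin n → 𝔽) → (Fin n → 𝔽)) : Prop :=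
  ∀ ω ω' : List (Fin n), IsUpdateOrderSDS ω → IsUpdateOrderSDS ω' →
    perSDS 𝔉 ω = perSDS 𝔉 ω'

/-- `𝔉` is π-independent: all simple update orders give the same set of periodic states. -/
def PiIndepSDS {n : ℕ} {𝔽 : Type*}
    (𝔉 : Fin n → (Fin n → 𝔽) → (Fin n → 𝔽)) : Prop :=
  ∀ π π' : List (Fin n), IsSimpleOrderSDS π → IsSimpleOrderSDS π' →
    perSDS 𝔉 π = perSDS 𝔉 π'

/-- An injective semiconjugacy preserves and reflects periodic states. -/
theorem isPeriodicState_apply_iff_of_semiconj {α β : Type*} {F : α → α} {G : β → β}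
    {H : α → β} (hH : Function.Injective H) (h : Function.Semiconj H F G) (y : α) :
    IsPeriodicState G (H y) ↔ IsPeriodicState F y := by
  unfold IsPeriodicState
  refine exists_congr fun m => and_congr_right fun _ => ?_
  rw [← (h.iterate_right m).eq y, hH.eq_iff]

/-- Dynamical equivalence: a conjugating bijection carries periodic sets to
periodic sets, and transfers ω-independence. -/
theorem dynamical_equivalence (n : ℕ) (hn : 1 ≤ n) (𝔽 : Type*) [Field 𝔽]
    [Fintype 𝔽] (Y : SimpleGraph (Fin n))
    (𝔉 𝔉' : Fin n → (Fin n → 𝔽) → (Fin n → 𝔽))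
    (hloc : ∀ i : Fin n, IsLocalAt Y (𝔉 i) i)
    (hloc' : ∀ i : Fin n, IsLocalAt Y (𝔉' i) i)
    (H : (Fin n → 𝔽) → (Fin n → 𝔽)) (hH : Function.Bijective H) :
    (∀ ω ω' : List (Fin n), IsUpdateOrderSDS ω → IsUpdateOrderSDS ω' →
      H ∘ sdsMap 𝔉 ω = sdsMap 𝔉' ω' ∘ H →
      Set.BijOn H (perSDS 𝔉 ω) (perSDS 𝔉' ω')) ∧
    (OmegaIndepSDS 𝔉' →
      (∀ ω : List (Fin n), IsUpdateOrderSDS ω → ∃ ω' : List (Fin n),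
        IsUpdateOrderSDS ω' ∧ H ∘ sdsMap 𝔉 ω = sdsMap 𝔉' ω' ∘ H) →
      OmegaIndepSDS 𝔉) := by
  have mem_iff : ∀ ω ω' : List (Fin n), H ∘ sdsMap 𝔉 ω = sdsMap 𝔉' ω' ∘ H →
      ∀ y, H y ∈ perSDS 𝔉' ω' ↔ y ∈ perSDS 𝔉 ω := fun ω ω' h =>
    isPeriodicState_apply_iff_of_semiconj hH.injective (congrFun h)
  constructor
  · intro ω ω' _ _ h
    refine ⟨fun y => (mem_iff ω ω' h y).2, hH.injective.injOn, fun z hz => ?_⟩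
    obtain ⟨y, rfl⟩ := hH.surjective z
    exact ⟨y, (mem_iff ω ω' h y).1 hz, rfl⟩
  · intro hind hex ω₁ ω₂ h₁ h₂
    obtain ⟨ω₁', h₁', e₁⟩ := hex ω₁ h₁
    obtain ⟨ω₂', h₂', e₂⟩ := hex ω₂ h₂
    ext y
    rw [← mem_iff ω₁ ω₁' e₁, ← mem_iff ω₂ ω₂' e₂, hind ω₁' ω₂' h₁' h₂']
end

section
/- For every n > 3 and every 0 ≤ k ≤ 255, Wolfram rule k is ω-independent on Circ_n if and only if Wolfram rule refl(k) is ω-independent on Circ_n. -/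
/-- State of the ACA: a cyclic binary string indexed by `ZMod n`. -/
abbrev AcaState (n : ℕ) := ZMod n → Fin 2

/-- Wolfram rule `k` applied at vertex `i`: update coordinate `i` to the binary
digit `a_j` of `k`, where `j = 4·y(i-1) + 2·y(i) + y(i+1)`. -/
def wolfRule (n k : ℕ) (i : ZMod n) (y : AcaState n) : AcaState n :=
  Function.update y i
    (if Nat.testBit k (4 * (y (i - 1)).val + 2 * (y i).val + (y (i + 1)).val)
     then 1 else 0)

/-- The ACA map `[k,ω]ₙ = Wolf_{ω_m} ∘ ⋯ ∘ Wolf_{ω_1}`. -/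
def acaMap (n k : ℕ) (ω : List (ZMod n)) (y : AcaState n) : AcaState n :=
  ω.foldl (fun s i => wolfRule n k i s) y

/-- An update order: a list containing every vertex at least once. -/
def IsUpdateOrder (n : ℕ) (ω : List (ZMod n)) : Prop :=
  ∀ v : ZMod n, v ∈ ω

/-- A simple update order: a list containing every vertex exactly once. -/
def IsSimpleUpdateOrder (n : ℕ) (ω : List (ZMod n)) : Prop :=
  ω.Nodup ∧ ∀ v : ZMod n, v ∈ ω

/-- `Per[k,ω]ₙ`: the set of periodic states of the ACA map. -/
def perSet (n k : ℕ) (ω : List (ZMod n)) : Set (AcaState n) :=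
  {y | IsPeriodicState (acaMap n k ω) y}

/-- Rule `k` is ω-independent on `Circ n`. -/
def OmegaIndepOn (n k : ℕ) : Prop :=
  ∀ ω ω' : List (ZMod n), IsUpdateOrder n ω → IsUpdateOrder n ω' →
    perSet n k ω = perSet n k ω'

/-- Rule `k` is ω-independent: ω-independent on `Circ n` for every `n > 3`. -/
def OmegaIndep (k : ℕ) : Prop :=
  ∀ n : ℕ, 3 < n → OmegaIndepOn n k

/-- The reflection of a state: `R(y)(i) = y(-i)`. -/
def reflState (n : ℕ) (y : AcaState n) : AcaState n := fun i => y (-i)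

/-- The reflection of a Wolfram rule: its binary digits satisfy
`a'_{4b+2c+d} = a_{4d+2c+b}`. -/
def reflRule (k : ℕ) : ℕ :=
  (Finset.range 8).sum fun j =>
    if Nat.testBit k (4 * (j % 2) + 2 * (j / 2 % 2) + j / 4) then 2 ^ j else 0

theorem testBit_reflRule (k : ℕ) (b c d : Fin 2) :
    (reflRule k).testBit (4 * b.val + 2 * c.val + d.val) =
      k.testBit (4 * d.val + 2 * c.val + b.val) := by
  simp only [reflRule, Finset.sum_range_succ, Finset.sum_range_zero, Nat.reduceMod,
    Nat.reduceDiv, Nat.reduceMul, Nat.reduceAdd]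
  fin_cases b <;> fin_cases c <;> fin_cases d <;>
    simp only [Nat.reduceMul, Nat.reduceAdd] <;>
    generalize k.testBit 0 = a₀ <;> generalize k.testBit 1 = a₁ <;>
    generalize k.testBit 2 = a₂ <;> generalize k.testBit 3 = a₃ <;>
    generalize k.testBit 4 = a₄ <;> generalize k.testBit 5 = a₅ <;>
    generalize k.testBit 6 = a₆ <;> generalize k.testBit 7 = a₇ <;>
    revert a₀ a₁ a₂ a₃ a₄ a₅ a₆ a₇ <;> decide

theorem reflState_reflState (n : ℕ) (y : AcaState n) : reflState n (reflState n y) = y := by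
  funext i
  simp [reflState]

theorem reflState_wolfRule (n k : ℕ) (i : ZMod n) (y : AcaState n) :
    reflState n (wolfRule n k i y) = wolfRule n (reflRule k) (-i) (reflState n y) := by
  funext j
  have hl : -(-i - 1) = i + 1 := by ring
  have hr : -(-i + 1) = i - 1 := by ring
  simp only [wolfRule, testBit_reflRule, reflState, hl, hr, neg_neg, Function.update_apply,
    neg_eq_iff_eq_neg]

theorem reflState_acaMap (n k : ℕ) (ω : List (ZMod n)) (y : AcaState n) :
    reflState n (acaMap n k ω y) =
      acaMap n (reflRule k) (ω.map Neg.neg) (reflState n y) := by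
  induction ω generalizing y with
  | nil => rfl
  | cons i ω ih =>
    have h := ih (wolfRule n k i y)
    rw [reflState_wolfRule] at h
    exact h

theorem reflState_mem_perSet_iff (n k : ℕ) (ω : List (ZMod n)) (y : AcaState n) :
    reflState n y ∈ perSet n (reflRule k) (ω.map Neg.neg) ↔ y ∈ perSet n k ω := by
  have hinj : Function.Injective (reflState n) :=
    Function.LeftInverse.injective (reflState_reflState n)
  have hsemi : Function.Semiconj (reflState n) (acaMap n k ω)
      (acaMap n (reflRule k) (ω.map Neg.neg)) := reflState_acaMap n k ω
  refine exists_congr fun m => and_congr_right fun _ => ?_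
  rw [← (hsemi.iterate_right m).eq y, hinj.eq_iff]

theorem IsUpdateOrder.map_neg {n : ℕ} {ω : List (ZMod n)} (h : IsUpdateOrder n ω) :
    IsUpdateOrder n (ω.map Neg.neg) :=
  fun v => List.mem_map.2 ⟨-v, h (-v), neg_neg v⟩

/-- Rule `k` is ω-independent on `Circ n` iff its reflection is. -/
theorem omegaIndepOn_reflRule_iff (n : ℕ) (hn : 3 < n) (k : ℕ) (hk : k ≤ 255) :
    OmegaIndepOn n k ↔ OmegaIndepOn n (reflRule k) := by
  constructor
  · intro h ω ω' hω hω'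
    have key : ∀ (τ : List (ZMod n)) (z : AcaState n),
        z ∈ perSet n (reflRule k) τ ↔ reflState n z ∈ perSet n k (τ.map Neg.neg) := by
      intro τ z
      rw [← reflState_mem_perSet_iff n k, reflState_reflState, List.map_map]
      simp
    ext z
    rw [key, key, h _ _ hω.map_neg hω'.map_neg]
  · intro h ω ω' hω hω'
    ext y
    rw [← reflState_mem_perSet_iff, ← reflState_mem_perSet_iff n k ω',
      h _ _ hω.map_neg hω'.map_neg]
end

section
/- For every n > 3 and every 0 ≤ k ≤ 255, Wolfram rule k is ω-independent on Circ_n if and only if Wolfram rule inv(k) is ω-independent on Circ_n. -/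
/-- The inversion of a state: `I(y)(i) = 1 - y(i)`. -/
def invState (n : ℕ) (y : AcaState n) : AcaState n := fun i => 1 - y i

/-- The inversion of a Wolfram rule: its binary digits satisfy
`a'_j = 1 - a_{7-j}`. -/
def invRule (k : ℕ) : ℕ :=
  (Finset.range 8).sum fun j =>
    if Nat.testBit k (7 - j) then 0 else 2 ^ j

theorem testBit_invRule (k : ℕ) (hk : k < 256) (j : ℕ) (hj : j < 8) :
    Nat.testBit (invRule k) j = !Nat.testBit k (7 - j) := by
  have h : ∀ k < 256, ∀ j < 8,
      Nat.testBit (invRule k) j = !Nat.testBit k (7 - j) := by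
    decide +kernel
  exact h k hk j hj

theorem invState_involutive (n : ℕ) : Function.Involutive (invState n) := fun y => by
  funext i
  simp [invState]

theorem invState_wolfRule (n k : ℕ) (hk : k < 256) (i : ZMod n) (y : AcaState n) :
    invState n (wolfRule n (invRule k) i y) = wolfRule n k i (invState n y) := by
  have index_lt (a b c : Fin 2) : 4 * a.val + 2 * b.val + c.val < 8 := by omega
  have index_inv (a b c : Fin 2) :
      7 - (4 * a.val + 2 * b.val + c.val) =
        4 * (1 - a).val + 2 * (1 - b).val + (1 - c).val := by
    decide +revert
  funext v
  by_cases hv : v = i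
  · subst hv
    simp only [invState, wolfRule, Function.update_self]
    rw [testBit_invRule k hk _ (index_lt _ _ _), index_inv]
    split_ifs <;> simp_all
  · simp [invState, wolfRule, hv]

theorem semiconj_invState_acaMap (n k : ℕ) (hk : k < 256) (ω : List (ZMod n)) :
    Function.Semiconj (invState n) (acaMap n (invRule k) ω) (acaMap n k ω) := by
  induction ω with
  | nil => exact fun _ => rfl
  | cons i ω ih =>
    intro y
    simpa only [acaMap, List.foldl_cons, invState_wolfRule n k hk] using
      ih (wolfRule n (invRule k) i y)

theorem perSet_invRule (n k : ℕ) (hk : k < 256) (ω : List (ZMod n)) :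
    perSet n (invRule k) ω = invState n ⁻¹' perSet n k ω := by
  ext y
  refine exists_congr fun m => and_congr_right fun _ => ?_
  rw [← (semiconj_invState_acaMap n k hk ω).iterate_right m y]
  exact (invState_involutive n).injective.eq_iff.symm

/-- Rule `k` is ω-independent on `Circ n` iff its inversion is. -/
theorem omegaIndepOn_invRule_iff (n : ℕ) (hn : 3 < n) (k : ℕ) (hk : k ≤ 255) :
    OmegaIndepOn n k ↔ OmegaIndepOn n (invRule k) := by
  unfold OmegaIndepOn
  simp only [perSet_invRule n k (Nat.lt_succ_of_le hk),
    (invState_involutive n).surjective.preimage_injective.eq_iff]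
end

section
/- For every k ∈ {51, 54, 57, 60, 99, 102, 105, 108, 147, 150, 153, 156, 195, 198, 201, 204}, every n > 3, and every vertex i ∈ ZMod n, the local function Wolf_i^k is a bijection of the state space; consequently, for every update order ω, Per[k,ω]_n is the entire state space, and Wolfram rule k is ω-independent. -/
/-- The new value of a vertex with value `b`, left neighbour `a` and right neighbour `c`. -/
def wolfDigit (k : ℕ) (a b c : Fin 2) : Fin 2 :=
  if Nat.testBit k (4 * a.val + 2 * b.val + c.val) then 1 else 0

theorem wolfRule_eq_update (n k : ℕ) (i : ZMod n) (y : AcaState n) :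
    wolfRule n k i y = Function.update y i (wolfDigit k (y (i - 1)) (y i) (y (i + 1))) :=
  rfl

theorem wolfRule_involutive {n k : ℕ} (hn : 1 < n)
    (hk : ∀ a c : Fin 2, Function.Involutive fun b => wolfDigit k a b c) (i : ZMod n) :
    Function.Involutive (wolfRule n k i) := by
  intro y
  have : Fact (1 < n) := ⟨hn⟩
  have hpred : i - 1 ≠ i := by simp
  have hsucc : i + 1 ≠ i := by simp
  have hdigit := hk (y (i - 1)) (y (i + 1)) (y i)
  simp only at hdigit
  simp [wolfRule_eq_update, hpred, hsucc, hdigit]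

theorem acaMap_injective {n k : ℕ} (h : ∀ i, Function.Injective (wolfRule n k i))
    (ω : List (ZMod n)) : Function.Injective (acaMap n k ω) := by
  induction ω with
  | nil => exact fun _ _ hxy => hxy
  | cons i ω ih => exact ih.comp (h i)

theorem perSet_eq_univ {n k : ℕ} [NeZero n] (h : ∀ i, Function.Injective (wolfRule n k i))
    (ω : List (ZMod n)) : perSet n k ω = Set.univ :=
  Set.eq_univ_of_forall fun y => (acaMap_injective h ω).mem_periodicPts y

theorem wolfDigit_involutive {k : ℕ}
    (hk : k ∈ ({51, 54, 57, 60, 99, 102, 105, 108, 147, 150, 153, 156, 195,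
      198, 201, 204} : Set ℕ)) (a c : Fin 2) :
    Function.Involutive fun b => wolfDigit k a b c := by
  simp only [Set.mem_insert_iff, Set.mem_singleton_iff] at hk
  unfold Function.Involutive
  rcases hk with rfl | rfl | rfl | rfl | rfl | rfl | rfl | rfl | rfl | rfl | rfl | rfl | rfl |
    rfl | rfl | rfl <;> revert a c <;> decide

/-- The 16 bijective Wolfram rules: their local functions are bijections, all
states are periodic, and they are ω-independent. -/
theorem bijective_rules_omegaIndep (k : ℕ)
    (hk : k ∈ ({51, 54, 57, 60, 99, 102, 105, 108, 147, 150, 153, 156, 195,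
      198, 201, 204} : Set ℕ)) :
    (∀ n : ℕ, 3 < n → ∀ i : ZMod n, Function.Bijective (wolfRule n k i)) ∧
    (∀ n : ℕ, 3 < n → ∀ ω : List (ZMod n), IsUpdateOrder n ω →
      perSet n k ω = Set.univ) ∧
    OmegaIndep k := by
  have hinv (n : ℕ) (hn : 3 < n) (i : ZMod n) : Function.Involutive (wolfRule n k i) :=
    wolfRule_involutive (by omega) (wolfDigit_involutive hk) i
  have hper (n : ℕ) (hn : 3 < n) (ω : List (ZMod n)) : perSet n k ω = Set.univ :=
    have : NeZero n := ⟨by omega⟩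
    perSet_eq_univ (fun i => (hinv n hn i).injective) ω
  exact ⟨fun n hn i => (hinv n hn i).bijective, fun n hn ω _ => hper n hn ω,
    fun n hn ω ω' _ _ => (hper n hn ω).trans (hper n hn ω').symm⟩
end

section
/- Let 0 ≤ k ≤ 255 have binary digits a_0,…,a_7 with a_0 = a_1 = a_4 = a_5 = 0. Then for every n > 3, every update order ω on ZMod n, and every state y that is periodic for the ACA map [k,ω]_n, y is fixed by every local function Wolf_i^k (i ∈ ZMod n). -/
/-- When the digits of `k` at the neighbourhoods with centre `0` vanish, updating a vertex can
only decrease a state. -/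
theorem wolfRule_le {k : ℕ} (h0 : Nat.testBit k 0 = false) (h1 : Nat.testBit k 1 = false)
    (h4 : Nat.testBit k 4 = false) (h5 : Nat.testBit k 5 = false) (n : ℕ) (i : ZMod n)
    (y : AcaState n) : wolfRule n k i y ≤ y := by
  refine update_le_self_iff.2 ?_
  generalize y (i - 1) = a, y i = b, y (i + 1) = c
  fin_cases b
  · fin_cases a <;> fin_cases c <;> simp [h0, h1, h4, h5]
  · split_ifs <;> simp

/-- A left fold of deflationary maps is deflationary. -/
theorem List.foldl_le_of_forall_le {α β : Type*} [Preorder α] {f : α → β → α}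
    (hf : ∀ s i, f s i ≤ s) (l : List β) (s : α) : l.foldl f s ≤ s := by
  induction l generalizing s with
  | nil => exact le_rfl
  | cons i l ih => exact (ih (f s i)).trans (hf s i)

/-- A point fixed by a left fold of deflationary maps is fixed by each of them. -/
theorem List.eq_of_foldl_eq_of_forall_le {α β : Type*} [PartialOrder α] {f : α → β → α}
    (hf : ∀ s i, f s i ≤ s) {l : List β} {s : α} (h : l.foldl f s = s) {i : β} (hi : i ∈ l) :
    f s i = s := by
  induction l with
  | nil => simp at hi
  | cons j l ih =>
    rw [List.foldl_cons] at h
    have hj : f s j = s :=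
      (hf s j).antisymm (h.ge.trans (List.foldl_le_of_forall_le hf l (f s j)))
    rcases List.mem_cons.1 hi with rfl | hi
    · exact hj
    · exact ih (by rwa [hj] at h) hi

/-- A periodic state of a deflationary map is fixed. -/
theorem IsPeriodicState.eq_of_forall_le {α : Type*} [PartialOrder α] {F : α → α}
    (hF : ∀ s, F s ≤ s) {y : α} (hy : IsPeriodicState F y) : F y = y := by
  obtain ⟨m, hm, h⟩ := hy
  obtain ⟨m, rfl⟩ := Nat.exists_eq_add_of_le' hm
  rw [Function.iterate_succ_apply] at h
  exact (hF y).antisymm (h.ge.trans (Function.iterate_le_id_of_le_id hF m (F y)))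

/-- If `a_0 = a_1 = a_4 = a_5 = 0` then every periodic state of any ACA map for
rule `k` is fixed by every local function. -/
theorem periodic_fixed_of_digits_zero (k : ℕ) (hk : k ≤ 255)
    (h0 : Nat.testBit k 0 = false) (h1 : Nat.testBit k 1 = false)
    (h4 : Nat.testBit k 4 = false) (h5 : Nat.testBit k 5 = false)
    (n : ℕ) (hn : 3 < n) (ω : List (ZMod n)) (hω : IsUpdateOrder n ω)
    (y : AcaState n) (hy : IsPeriodicState (acaMap n k ω) y) :
    ∀ i : ZMod n, wolfRule n k i y = y := by
  have hle := wolfRule_le h0 h1 h4 h5 n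
  have hfix : acaMap n k ω y = y :=
    hy.eq_of_forall_le (List.foldl_le_of_forall_le (fun s i => hle i s) ω)
  exact fun i => List.eq_of_foldl_eq_of_forall_le (fun s i => hle i s) hfix (hω i)
end

section
/- For every k ∈ {160, 164, 168, 172, 232}, every n > 3, and every update order ω on ZMod n, every periodic state of the ACA map [k,ω]_n is a fixed point of [k,ω]_n; consequently Wolfram rule k is ω-independent. -/
/-- The contribution of a pair of neighbouring cells to the energy: `1` for each boundary between
blocks, and `1` for each cell in state `1` (counted at the left end of the pair). -/
def edgeEnergy (a b : Fin 2) : ℕ :=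
  (if a = b then 0 else 1) + a.val

/-- The number of block boundaries plus the number of ones of a cyclic binary string. -/
def acaEnergy (n : ℕ) [NeZero n] (y : AcaState n) : ℕ :=
  ∑ i, edgeEnergy (y i) (y (i + 1))

/-- Changing one cell changes only the contributions of the two edges at that cell. -/
theorem acaEnergy_update_lt {n : ℕ} [NeZero n] (hn : 1 < n) (y : AcaState n) (i : ZMod n)
    (b : Fin 2)
    (h : edgeEnergy (y (i - 1)) b + edgeEnergy b (y (i + 1)) <
      edgeEnergy (y (i - 1)) (y i) + edgeEnergy (y i) (y (i + 1))) :
    acaEnergy n (Function.update y i b) < acaEnergy n y := by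
  have : Fact (1 < n) := ⟨hn⟩
  have hpred : i - 1 ≠ i := by simp
  have hsucc : i + 1 ≠ i := by simp
  have split (z : AcaState n) : acaEnergy n z =
      edgeEnergy (z i) (z (i + 1)) + (edgeEnergy (z (i - 1)) (z i) +
        ∑ j ∈ (Finset.univ.erase i).erase (i - 1), edgeEnergy (z j) (z (j + 1))) := by
    have hmem : i - 1 ∈ Finset.univ.erase i := by simp
    have hedge := Finset.add_sum_erase _ (fun j => edgeEnergy (z j) (z (j + 1))) hmem
    rw [sub_add_cancel] at hedge
    rw [acaEnergy, hedge, Finset.add_sum_erase _ (fun j => edgeEnergy (z j) (z (j + 1)))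
      (Finset.mem_univ i)]
  have hrest : ∑ j ∈ (Finset.univ.erase i).erase (i - 1),
        edgeEnergy (Function.update y i b j) (Function.update y i b (j + 1)) =
      ∑ j ∈ (Finset.univ.erase i).erase (i - 1), edgeEnergy (y j) (y (j + 1)) := by
    refine Finset.sum_congr rfl fun j hj => ?_
    simp only [Finset.mem_erase, Finset.mem_univ, and_true] at hj
    have hj' : j + 1 ≠ i := fun h => hj.1 (eq_sub_of_add_eq h)
    rw [Function.update_of_ne hj.2, Function.update_of_ne hj']
  rw [split, split, hrest, Function.update_self, Function.update_of_ne hpred,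
    Function.update_of_ne hsucc]
  omega

theorem wolfRule_eq_or_acaEnergy_lt {k : ℕ} (hk : k ∈ ({160, 164, 168, 172, 232} : Set ℕ))
    {n : ℕ} [NeZero n] (hn : 1 < n) (i : ZMod n) (y : AcaState n) :
    wolfRule n k i y = y ∨ acaEnergy n (wolfRule n k i y) < acaEnergy n y := by
  have key : ∀ a b c : Fin 2,
      (if Nat.testBit k (4 * a.val + 2 * b.val + c.val) then 1 else 0) = b ∨
        edgeEnergy a (if Nat.testBit k (4 * a.val + 2 * b.val + c.val) then 1 else 0) +
            edgeEnergy (if Nat.testBit k (4 * a.val + 2 * b.val + c.val) then 1 else 0) c <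
          edgeEnergy a b + edgeEnergy b c := by
    rcases hk with rfl | rfl | rfl | rfl | rfl <;> decide
  rcases key (y (i - 1)) (y i) (y (i + 1)) with h | h
  · left
    rw [wolfRule, h, Function.update_eq_self]
  · exact Or.inr (acaEnergy_update_lt hn y i _ h)

theorem acaMap_eq_self {n k : ℕ} {ω : List (ZMod n)} {y : AcaState n}
    (h : ∀ i ∈ ω, wolfRule n k i y = y) : acaMap n k ω y = y := by
  induction ω with
  | nil => rfl
  | cons i ω ih =>
    rw [acaMap, List.foldl_cons, h i List.mem_cons_self]
    exact ih fun j hj => h j (List.mem_cons_of_mem i hj)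

theorem fixed_or_acaEnergy_acaMap_lt {k : ℕ} (hk : k ∈ ({160, 164, 168, 172, 232} : Set ℕ))
    {n : ℕ} [NeZero n] (hn : 1 < n) (ω : List (ZMod n)) (y : AcaState n) :
    (∀ i ∈ ω, wolfRule n k i y = y) ∨ acaEnergy n (acaMap n k ω y) < acaEnergy n y := by
  induction ω generalizing y with
  | nil => simp
  | cons i ω ih =>
    have hcons : acaMap n k (i :: ω) y = acaMap n k ω (wolfRule n k i y) := rfl
    rcases wolfRule_eq_or_acaEnergy_lt hk hn i y with h | h
    · rw [hcons, h, List.forall_mem_cons]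
      exact (ih y).imp_left fun hω => ⟨h, hω⟩
    · right
      rw [hcons]
      rcases ih (wolfRule n k i y) with hω | hω
      · rwa [acaMap_eq_self hω]
      · exact hω.trans h

/-- A map that never increases a potential does not decrease it at a periodic state. -/
theorem IsPeriodicState.le_map {α : Type*} {F : α → α} {E : α → ℕ} (hE : ∀ x, E (F x) ≤ E x)
    {y : α} (hy : IsPeriodicState F y) : E y ≤ E (F y) := by
  obtain ⟨m, hm, hper⟩ := hy
  obtain ⟨m, rfl⟩ := Nat.exists_eq_add_of_le' hm
  have iterate_le (r : ℕ) (x : α) : E (F^[r] x) ≤ E x := by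
    induction r generalizing x with
    | zero => rfl
    | succ r ih => exact (ih (F x)).trans (hE x)
  calc E y = E (F^[m] (F y)) := by rw [← Function.iterate_succ_apply, hper]
    _ ≤ E (F y) := iterate_le m (F y)

/-- The periodic states are exactly the states fixed by the rule at every vertex. -/
theorem mem_perSet_iff_forall_wolfRule_eq {k : ℕ}
    (hk : k ∈ ({160, 164, 168, 172, 232} : Set ℕ)) {n : ℕ} (hn : 1 < n)
    {ω : List (ZMod n)} (hω : IsUpdateOrder n ω) (y : AcaState n) :
    y ∈ perSet n k ω ↔ ∀ i, wolfRule n k i y = y := by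
  have : NeZero n := ⟨by omega⟩
  have hdec := fixed_or_acaEnergy_acaMap_lt hk hn ω
  constructor
  · intro hy i
    have hmono (x : AcaState n) : acaEnergy n (acaMap n k ω x) ≤ acaEnergy n x := by
      rcases hdec x with h | h
      · rw [acaMap_eq_self h]
      · exact h.le
    exact (hdec y).resolve_right (IsPeriodicState.le_map hmono hy).not_gt i (hω i)
  · exact fun h => ⟨1, le_rfl, acaMap_eq_self fun i _ => h i⟩

/-- Rules 160, 164, 168, 172 and 232: all periodic states are fixed states, and
these rules are ω-independent. -/
theorem rules_B_omegaIndep (k : ℕ)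
    (hk : k ∈ ({160, 164, 168, 172, 232} : Set ℕ)) :
    (∀ n : ℕ, 3 < n → ∀ ω : List (ZMod n), IsUpdateOrder n ω →
      ∀ y ∈ perSet n k ω, acaMap n k ω y = y) ∧
    OmegaIndep k := by
  constructor
  · intro n hn ω hω y hy
    have hfix := (mem_perSet_iff_forall_wolfRule_eq hk (by omega) hω y).1 hy
    exact acaMap_eq_self fun i _ => hfix i
  · intro n hn ω ω' hω hω'
    ext y
    rw [mem_perSet_iff_forall_wolfRule_eq hk (by omega) hω,
      mem_perSet_iff_forall_wolfRule_eq hk (by omega) hω']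
end

section
/- For every k ∈ {1, 9, 73, 129, 137}, Wolfram rule k is ω-independent, i.e., for every n > 3 and all update orders ω, ω' on ZMod n, Per[k,ω]_n = Per[k,ω']_n. -/
/-- The binary digits shared by the rules 1, 9, 73, 129 and 137: a vertex with both neighbours `0`
is flipped, and a `0` with a neighbour `1` is kept. -/
structure IsIsolatedFlipRule (k : ℕ) : Prop where
  bit_zero : k.testBit 0 = true
  bit_one : k.testBit 1 = false
  bit_two : k.testBit 2 = false
  bit_four : k.testBit 4 = false
  bit_five : k.testBit 5 = false

/-- The positions `i` such that `y i` and `y (i + 1)` are both `1`. -/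
def adjacentOnes {n : ℕ} (y : AcaState n) : Set (ZMod n) :=
  {i | y i = 1 ∧ y (i + 1) = 1}

/-- States in which no single update changes the set of adjacent ones. -/
def stableStates (n k : ℕ) : Set (AcaState n) :=
  {y | ∀ i, adjacentOnes (wolfRule n k i y) = adjacentOnes y}

theorem fin_two_eq_zero_or_one (a : Fin 2) : a = 0 ∨ a = 1 := by
  lia

theorem wolfRule_apply_self (n k : ℕ) (i : ZMod n) (y : AcaState n) :
    wolfRule n k i y i =
      if Nat.testBit k (4 * (y (i - 1)).val + 2 * (y i).val + (y (i + 1)).val) then 1 else 0 := by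
  simp [wolfRule]

theorem wolfRule_apply_of_ne (n k : ℕ) {i j : ZMod n} (h : j ≠ i) (y : AcaState n) :
    wolfRule n k i y j = y j := by
  simp [wolfRule, h]

theorem wolfRule_eq_self {n k : ℕ} {i : ZMod n} {y : AcaState n}
    (h : wolfRule n k i y i = y i) : wolfRule n k i y = y := by
  funext j
  by_cases hj : j = i
  · rw [hj, h]
  · exact wolfRule_apply_of_ne n k hj y

theorem adjacentOnes_congr {n : ℕ} [Fact (1 < n)] {i : ZMod n} {y z : AcaState n}
    (hyz : ∀ j, j ≠ i → z j = y j) (hl : y (i - 1) = 0) (hr : y (i + 1) = 0) :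
    adjacentOnes z = adjacentOnes y := by
  have h₁ : i - 1 ≠ i := by simp
  have h₂ : i + 1 ≠ i := by simp
  ext j
  simp only [adjacentOnes, Set.mem_ofPred_eq]
  by_cases hj : j = i
  · subst hj
    simp [hyz _ h₂, hr]
  by_cases hj' : j + 1 = i
  · have : j = i - 1 := eq_sub_of_add_eq hj'
    subst this
    simp [hyz _ h₁, hl]
  · rw [hyz j hj, hyz _ hj']

theorem adjacentOnes_wolfRule_of_isolated {n : ℕ} [Fact (1 < n)] (k : ℕ) {i : ZMod n}
    {y : AcaState n} (hl : y (i - 1) = 0) (hr : y (i + 1) = 0) :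
    adjacentOnes (wolfRule n k i y) = adjacentOnes y :=
  adjacentOnes_congr (fun _ hj => wolfRule_apply_of_ne n k hj y) hl hr

theorem wolfRule_of_one {n k : ℕ} {i : ZMod n} {y : AcaState n} (hi : y i = 1)
    (hnbr : ¬ (y (i - 1) = 0 ∧ y (i + 1) = 0))
    (h : adjacentOnes (wolfRule n k i y) = adjacentOnes y) : wolfRule n k i y = y := by
  apply wolfRule_eq_self
  rw [hi]
  rcases fin_two_eq_zero_or_one (y (i - 1)) with hl | hl
  · have hr : y (i + 1) = 1 := by
      rcases fin_two_eq_zero_or_one (y (i + 1)) with hr | hr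
      · exact absurd ⟨hl, hr⟩ hnbr
      · exact hr
    have : i ∈ adjacentOnes y := ⟨hi, hr⟩
    exact (h ▸ this).1
  · have : i - 1 ∈ adjacentOnes y := ⟨hl, by simpa using hi⟩
    have := (h ▸ this : i - 1 ∈ adjacentOnes (wolfRule n k i y)).2
    rwa [sub_add_cancel] at this

namespace IsIsolatedFlipRule

variable {n k : ℕ} (hk : IsIsolatedFlipRule k)
include hk

theorem wolfRule_of_isolated {i : ZMod n} {y : AcaState n}
    (hl : y (i - 1) = 0) (hr : y (i + 1) = 0) : wolfRule n k i y i = 1 - y i := by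
  rw [wolfRule_apply_self, hl, hr]
  rcases fin_two_eq_zero_or_one (y i) with h | h <;> simp [h, hk.bit_zero, hk.bit_two]

theorem wolfRule_of_zero {i : ZMod n} {y : AcaState n} (hi : y i = 0)
    (hnbr : ¬ (y (i - 1) = 0 ∧ y (i + 1) = 0)) : wolfRule n k i y = y := by
  apply wolfRule_eq_self
  rw [wolfRule_apply_self, hi]
  rcases fin_two_eq_zero_or_one (y (i - 1)) with h | h <;>
    rcases fin_two_eq_zero_or_one (y (i + 1)) with h' | h' <;>
    simp_all [hk.bit_one, hk.bit_four, hk.bit_five]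

variable [Fact (1 < n)]

theorem adjacentOnes_wolfRule_subset (i : ZMod n) (y : AcaState n) :
    adjacentOnes (wolfRule n k i y) ⊆ adjacentOnes y := by
  by_cases hnbr : y (i - 1) = 0 ∧ y (i + 1) = 0
  · exact (adjacentOnes_wolfRule_of_isolated k hnbr.1 hnbr.2).subset
  rcases fin_two_eq_zero_or_one (y i) with hi | hi
  · rw [hk.wolfRule_of_zero hi hnbr]
  have key (j : ZMod n) (hj : wolfRule n k i y j = 1) : y j = 1 := by
    by_cases h : j = i
    · rw [h, hi]
    · rwa [wolfRule_apply_of_ne n k h] at hj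
  exact fun j hj => ⟨key _ hj.1, key _ hj.2⟩

/-- The neighbourhood of a `1` having a neighbour `1` is determined by the adjacent ones. -/
theorem adjacentOnes_wolfRule_of_eq {i : ZMod n} {y z : AcaState n}
    (hyz : adjacentOnes y = adjacentOnes z)
    (h : adjacentOnes (wolfRule n k i y) = adjacentOnes y) :
    adjacentOnes (wolfRule n k i z) = adjacentOnes z := by
  by_cases hnbr : z (i - 1) = 0 ∧ z (i + 1) = 0
  · exact adjacentOnes_wolfRule_of_isolated k hnbr.1 hnbr.2
  rcases fin_two_eq_zero_or_one (z i) with hi | hi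
  · rw [hk.wolfRule_of_zero hi hnbr]
  have hright : y i = 1 ∧ y (i + 1) = 1 ↔ z i = 1 ∧ z (i + 1) = 1 := Set.ext_iff.1 hyz i
  have hleft : y (i - 1) = 1 ∧ y i = 1 ↔ z (i - 1) = 1 ∧ z i = 1 := by
    simpa [adjacentOnes] using Set.ext_iff.1 hyz (i - 1)
  have hcell : y (i - 1) = z (i - 1) ∧ y i = z i ∧ y (i + 1) = z (i + 1) := by
    generalize y (i - 1) = a, y i = b, y (i + 1) = c, z (i - 1) = a', z i = b',
      z (i + 1) = c' at *
    revert a b c a' b' c'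
    decide
  obtain ⟨el, ei, er⟩ := hcell
  have hy := wolfRule_of_one (ei.trans hi) (by rwa [el, er]) h
  rw [wolfRule_eq_self]
  rw [wolfRule_apply_self, ← el, ← ei, ← er, ← wolfRule_apply_self, hy]

theorem wolfRule_wolfRule {i : ZMod n} {y : AcaState n} (hy : y ∈ stableStates n k) :
    wolfRule n k i (wolfRule n k i y) = y := by
  by_cases hnbr : y (i - 1) = 0 ∧ y (i + 1) = 0
  · have hl : wolfRule n k i y (i - 1) = 0 := by
      rw [wolfRule_apply_of_ne n k (by simp), hnbr.1]
    have hr : wolfRule n k i y (i + 1) = 0 := by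
      rw [wolfRule_apply_of_ne n k (by simp), hnbr.2]
    funext j
    by_cases hj : j = i
    · rw [hj, hk.wolfRule_of_isolated hl hr, hk.wolfRule_of_isolated hnbr.1 hnbr.2, sub_sub_cancel]
    · rw [wolfRule_apply_of_ne n k hj, wolfRule_apply_of_ne n k hj]
  · have hfix : wolfRule n k i y = y := by
      rcases fin_two_eq_zero_or_one (y i) with hi | hi
      · exact hk.wolfRule_of_zero hi hnbr
      · exact wolfRule_of_one hi hnbr (hy i)
    rw [hfix, hfix]

theorem mapsTo_wolfRule (i : ZMod n) :
    Set.MapsTo (wolfRule n k i) (stableStates n k) (stableStates n k) :=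
  fun _ hy j => hk.adjacentOnes_wolfRule_of_eq (hy i).symm (hy j)

theorem injOn_wolfRule (i : ZMod n) : Set.InjOn (wolfRule n k i) (stableStates n k) :=
  fun _ hy _ hz h => by rw [← hk.wolfRule_wolfRule hy, h, hk.wolfRule_wolfRule hz]

theorem mapsTo_injOn_acaMap (ω : List (ZMod n)) :
    Set.MapsTo (acaMap n k ω) (stableStates n k) (stableStates n k) ∧
      Set.InjOn (acaMap n k ω) (stableStates n k) := by
  induction ω with
  | nil => exact ⟨fun _ h => h, fun _ _ _ _ h => h⟩
  | cons i ω ih =>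
    exact ⟨ih.1.comp (hk.mapsTo_wolfRule i), ih.2.comp (hk.injOn_wolfRule i) (hk.mapsTo_wolfRule i)⟩

theorem adjacentOnes_acaMap_subset (ω : List (ZMod n)) (y : AcaState n) :
    adjacentOnes (acaMap n k ω y) ⊆ adjacentOnes y := by
  induction ω generalizing y with
  | nil => exact subset_rfl
  | cons i ω ih => exact (ih _).trans (hk.adjacentOnes_wolfRule_subset i y)

theorem adjacentOnes_iterate_acaMap_subset (ω : List (ZMod n)) (m : ℕ) (y : AcaState n) :
    adjacentOnes ((acaMap n k ω)^[m] y) ⊆ adjacentOnes y := by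
  induction m generalizing y with
  | zero => exact subset_rfl
  | succ m ih => exact (ih _).trans (hk.adjacentOnes_acaMap_subset ω y)

theorem adjacentOnes_wolfRule_of_mem {ω : List (ZMod n)} {y : AcaState n}
    (h : adjacentOnes y ⊆ adjacentOnes (acaMap n k ω y)) {i : ZMod n} (hi : i ∈ ω) :
    adjacentOnes (wolfRule n k i y) = adjacentOnes y := by
  induction ω generalizing y with
  | nil => simp at hi
  | cons j ω ih =>
    have hsub := hk.adjacentOnes_wolfRule_subset j y
    have hj : adjacentOnes (wolfRule n k j y) = adjacentOnes y :=
      hsub.antisymm (h.trans (hk.adjacentOnes_acaMap_subset ω _))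
    rcases List.mem_cons.1 hi with rfl | hi
    · exact hj
    · exact hk.adjacentOnes_wolfRule_of_eq hj (ih (hsub.trans h) hi)

theorem perSet_eq_stableStates {ω : List (ZMod n)} (hω : IsUpdateOrder n ω) :
    perSet n k ω = stableStates n k := by
  have : NeZero n := ⟨(zero_lt_one.trans (Fact.out : 1 < n)).ne'⟩
  ext y
  constructor
  · rintro ⟨m, hm, hy⟩ i
    obtain ⟨m, rfl⟩ := Nat.exists_eq_add_of_le' hm
    refine hk.adjacentOnes_wolfRule_of_mem ?_ (hω i)
    have := hk.adjacentOnes_iterate_acaMap_subset ω m (acaMap n k ω y)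
    rwa [← Function.iterate_succ_apply, hy] at this
  · intro hy
    obtain ⟨hmaps, hinj⟩ := hk.mapsTo_injOn_acaMap (n := n) ω
    obtain ⟨m, hm, hper⟩ := (hmaps.restrict_inj.2 hinj).mem_periodicPts ⟨y, hy⟩
    refine ⟨m, hm, ?_⟩
    have := congrArg Subtype.val hper
    rwa [hmaps.iterate_restrict] at this

end IsIsolatedFlipRule

theorem IsIsolatedFlipRule.omegaIndep {k : ℕ} (hk : IsIsolatedFlipRule k) : OmegaIndep k := by
  intro n hn ω ω' hω hω'
  have : Fact (1 < n) := ⟨by lia⟩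
  rw [hk.perSet_eq_stableStates hω, hk.perSet_eq_stableStates hω']

/-- Rules 1, 9, 73, 129 and 137 are ω-independent. -/
theorem rules_D_omegaIndep (k : ℕ)
    (hk : k ∈ ({1, 9, 73, 129, 137} : Set ℕ)) :
    OmegaIndep k := by
  apply IsIsolatedFlipRule.omegaIndep
  rcases hk with rfl | rfl | rfl | rfl | rfl <;> constructor <;> decide
end
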